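/- Let r, d_s ≥ 1, d = r + d_s, σ_1, σ_2 > 0, μ_1 ∈ ℝ^r, and for each e ∈ {1,…,E} let μ_2^e ∈ ℝ^{d_s} and let Σ_2^e ∈ ℝ^{d_s×d_s} be a symmetric matrix with Σ_2^e ⪰ σ_2² I_{d_s}. For each e, let the training environment be the two-class Gaussian mixture with Y uniform on {±1} and X | Y = y ∼ N(y·(μ_1, μ_2^e), blockdiag(σ_1² I_r, Σ_2^e)), and let the corresponding test environment be identical except that the spurious mean is flipped: X | Y = y ∼ N(y·(μ_1, −μ_2^e), blockdiag(σ_1² I_r, Σ_2^e)). Then any β = (β_1, β_2) ∈ ℝ^r × ℝ^{d_s} with ‖β‖_2 = 1 whose classification accuracy P(sign(βᵀ X) = Y) is at least Φ(2‖μ_1‖ / min(σ_1, σ_2)) on every training environment e ∈ {1,…,E} has 0-1 error P(sign(βᵀ X) ≠ Y) at least 1/2 on every test environment. -/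

import Mathlib

open Matrix MeasureTheory

/-- `Φ`, the cumulative distribution function of the standard normal distribution `N(0,1)`. -/
noncomputable def stdGaussianCDF (x : ℝ) : ℝ :=
  ((ProbabilityTheory.gaussianReal 0 1) (Set.Iic x)).toReal

/-- The standard Gaussian measure on `ι → ℝ`, i.e. the product of `N(0,1)`. -/
noncomputable def stdGaussian (ι : Type*) [Fintype ι] : Measure (ι → ℝ) :=
  Measure.pi fun _ => ProbabilityTheory.gaussianReal 0 1

/-- Accuracy `P(sign(βᵀX) = Y)` of the sign classifier on the two-class Gaussian mixture
with `Y` uniform on `±1` and `X | Y = y` realized as `y·m + L z`, `z ∼ γ`. -/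
noncomputable def signAccuracy {ι : Type*} [Fintype ι]
    (β m : ι → ℝ) (L : Matrix ι ι ℝ) : ℝ :=
  (1 / 2) * ((stdGaussian ι) {z | 0 ≤ β ⬝ᵥ (m + L *ᵥ z)}).toReal
    + (1 / 2) * ((stdGaussian ι) {z | β ⬝ᵥ (-m + L *ᵥ z) < 0}).toReal

/-- 0-1 error `P(sign(βᵀX) ≠ Y)` of the sign classifier on the two-class Gaussian mixture
with `Y` uniform on `±1` and `X | Y = y` realized as `y·m + L z`, `z ∼ γ`. -/
noncomputable def signError {ι : Type*} [Fintype ι]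
    (β m : ι → ℝ) (L : Matrix ι ι ℝ) : ℝ :=
  (1 / 2) * ((stdGaussian ι) {z | β ⬝ᵥ (m + L *ᵥ z) < 0}).toReal
    + (1 / 2) * ((stdGaussian ι) {z | 0 ≤ β ⬝ᵥ (-m + L *ᵥ z)}).toReal

/-- A linear functional of a standard Gaussian vector is a centred Gaussian whose variance is the
squared norm of its coefficient vector. -/
theorem map_dotProduct_stdGaussian {ι : Type*} [Fintype ι] (c : ι → ℝ) :
    (stdGaussian ι).map (fun z => c ⬝ᵥ z) =
      ProbabilityTheory.gaussianReal 0 (c ⬝ᵥ c).toNNReal := by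
  have hmeas : Measurable fun z : ι → ℝ => c ⬝ᵥ z := by
    unfold dotProduct; fun_prop
  have : IsProbabilityMeasure (stdGaussian ι) := by unfold stdGaussian; infer_instance
  have : IsFiniteMeasure ((stdGaussian ι).map fun z => c ⬝ᵥ z) :=
    Measure.isFiniteMeasure_map _ _
  have hc : 0 ≤ c ⬝ᵥ c := Finset.sum_nonneg fun i _ => mul_self_nonneg (c i)
  apply Measure.ext_of_charFun
  ext t
  rw [charFun_apply_real, integral_map hmeas.aemeasurable (by fun_prop),
    ProbabilityTheory.charFun_gaussianReal]
  have hprod : ∀ z : ι → ℝ, Complex.exp (t * (c ⬝ᵥ z : ℝ) * Complex.I) =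
      ∏ i, Complex.exp ((t * c i : ℝ) * (z i : ℝ) * Complex.I) := by
    intro z
    rw [← Complex.exp_sum, dotProduct]
    push_cast
    rw [Finset.mul_sum, Finset.sum_mul]
    congr 1
    exact Finset.sum_congr rfl fun i _ => by ring
  simp_rw [hprod]
  unfold stdGaussian
  rw [integral_fintype_prod_eq_prod
    (fun i x => Complex.exp ((t * c i : ℝ) * (x : ℝ) * Complex.I))]
  simp_rw [← charFun_apply_real, ProbabilityTheory.charFun_gaussianReal]
  rw [← Complex.exp_sum, Real.coe_toNNReal _ hc, dotProduct]
  push_cast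
  congr 1
  simp only [mul_zero, zero_mul, zero_sub, one_mul, Finset.sum_mul, Finset.sum_div,
    Finset.sum_neg_distrib]
  congr 1
  exact Finset.sum_congr rfl fun i _ => by ring

theorem strictMono_stdGaussianCDF : StrictMono stdGaussianCDF := by
  intro x y hxy
  have hpos : ProbabilityTheory.gaussianReal 0 1 (Set.Ioc x y) ≠ 0 := fun h => by
    have := ProbabilityTheory.gaussianReal_absolutelyContinuous' 0 one_ne_zero h
    rw [Real.volume_Ioc, ENNReal.ofReal_eq_zero] at this
    linarith
  have hunion := measureReal_union (μ := ProbabilityTheory.gaussianReal 0 1)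
    (Set.Iic_disjoint_Ioc (le_refl x) (c := y)) measurableSet_Ioc
  rw [Set.Iic_union_Ioc_eq_Iic hxy.le] at hunion
  have : 0 < (ProbabilityTheory.gaussianReal 0 1).real (Set.Ioc x y) :=
    ENNReal.toReal_pos hpos (measure_ne_top _ _)
  change (ProbabilityTheory.gaussianReal 0 1).real _ < (ProbabilityTheory.gaussianReal 0 1).real _
  linarith

theorem gaussianReal_Iio_toReal (x : ℝ) :
    ((ProbabilityTheory.gaussianReal 0 1) (Set.Iio x)).toReal = stdGaussianCDF x := by
  have := ProbabilityTheory.nullSingletonClass_gaussianReal (μ := 0) (v := 1) one_ne_zero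
  rw [stdGaussianCDF, measure_congr Iio_ae_eq_Iic]

theorem gaussianReal_Ici_neg_toReal (x : ℝ) :
    ((ProbabilityTheory.gaussianReal 0 1) (Set.Ici (-x))).toReal = stdGaussianCDF x := by
  have h := ProbabilityTheory.gaussianReal_map_neg (μ := 0) (v := 1)
  rw [neg_zero] at h
  rw [← h, Measure.map_apply measurable_neg measurableSet_Ici, stdGaussianCDF]
  congr 2
  ext y
  simp

theorem stdGaussianCDF_zero : stdGaussianCDF 0 = 1 / 2 := by
  have h := gaussianReal_Ici_neg_toReal 0
  rw [neg_zero, ← Set.compl_Iio, prob_compl_eq_one_sub measurableSet_Iio,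
    ENNReal.toReal_sub_of_le prob_le_one ENNReal.one_ne_top, gaussianReal_Iio_toReal,
    ENNReal.toReal_one] at h
  linarith

/-- The law of `β ⬝ᵥ L z` is that of a standard Gaussian scaled by its standard deviation. -/
theorem stdGaussian_preimage_dotProduct_mulVec {ι : Type*} [Fintype ι]
    (β : ι → ℝ) (L : Matrix ι ι ℝ) {S : Set ℝ} (hS : MeasurableSet S) :
    stdGaussian ι {z | β ⬝ᵥ L *ᵥ z ∈ S} =
      ProbabilityTheory.gaussianReal 0 1 {x | √(β ⬝ᵥ (L * Lᵀ) *ᵥ β) * x ∈ S} := by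
  have hv : β ⬝ᵥ (L * Lᵀ) *ᵥ β = (β ᵥ* L) ⬝ᵥ (β ᵥ* L) := by
    rw [← mulVec_mulVec, dotProduct_mulVec, mulVec_transpose]
  have hc : 0 ≤ (β ᵥ* L) ⬝ᵥ (β ᵥ* L) := Finset.sum_nonneg fun i _ => mul_self_nonneg _
  have hmeas : Measurable fun z : ι → ℝ => (β ᵥ* L) ⬝ᵥ z := by
    unfold dotProduct; fun_prop
  have h1 := Measure.map_apply (μ := stdGaussian ι) hmeas hS
  have h2 := Measure.map_apply (μ := ProbabilityTheory.gaussianReal 0 1)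
    (measurable_const_mul √((β ᵥ* L) ⬝ᵥ (β ᵥ* L))) hS
  rw [ProbabilityTheory.gaussianReal_map_const_mul] at h2
  rw [map_dotProduct_stdGaussian] at h1
  simp_rw [hv, dotProduct_mulVec]
  refine h1.symm.trans (Eq.trans ?_ h2)
  congr 2
  · simp
  · ext
    simp [hc]

theorem signAccuracy_eq_stdGaussianCDF {ι : Type*} [Fintype ι]
    (β m : ι → ℝ) (L : Matrix ι ι ℝ) (hpos : 0 < β ⬝ᵥ (L * Lᵀ) *ᵥ β) :
    signAccuracy β m L = stdGaussianCDF (β ⬝ᵥ m / √(β ⬝ᵥ (L * Lᵀ) *ᵥ β)) := by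
  have hs := Real.sqrt_pos.2 hpos
  have h1 : {z | 0 ≤ β ⬝ᵥ (m + L *ᵥ z)} = {z | β ⬝ᵥ L *ᵥ z ∈ Set.Ici (-(β ⬝ᵥ m))} := by
    ext z
    simp only [dotProduct_add, Set.mem_ofPred_eq, Set.mem_Ici]
    constructor <;> intro h <;> linarith
  have h2 : {z | β ⬝ᵥ (-m + L *ᵥ z) < 0} = {z | β ⬝ᵥ L *ᵥ z ∈ Set.Iio (β ⬝ᵥ m)} := by
    ext z
    simp only [dotProduct_add, dotProduct_neg, Set.mem_ofPred_eq, Set.mem_Iio]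
    constructor <;> intro h <;> linarith
  rw [signAccuracy, h1, h2, stdGaussian_preimage_dotProduct_mulVec _ _ measurableSet_Ici,
    stdGaussian_preimage_dotProduct_mulVec _ _ measurableSet_Iio]
  set s := √(β ⬝ᵥ (L * Lᵀ) *ᵥ β)
  have h3 : {x | s * x ∈ Set.Ici (-(β ⬝ᵥ m))} = Set.Ici (-(β ⬝ᵥ m / s)) := by
    ext x
    simp only [Set.mem_ofPred_eq, Set.mem_Ici]
    rw [← neg_div, div_le_iff₀' hs]
  have h4 : {x | s * x ∈ Set.Iio (β ⬝ᵥ m)} = Set.Iio (β ⬝ᵥ m / s) := by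
    ext x
    simp only [Set.mem_ofPred_eq, Set.mem_Iio]
    rw [lt_div_iff₀' hs]
  rw [h3, h4, gaussianReal_Ici_neg_toReal, gaussianReal_Iio_toReal]
  ring

theorem signError_eq_one_sub_signAccuracy {ι : Type*} [Fintype ι]
    (β m : ι → ℝ) (L : Matrix ι ι ℝ) : signError β m L = 1 - signAccuracy β m L := by
  have : IsProbabilityMeasure (stdGaussian ι) := by unfold stdGaussian; infer_instance
  have hmeas : ∀ v : ι → ℝ, Measurable fun z : ι → ℝ => β ⬝ᵥ (v + L *ᵥ z) := by
    intro v
    unfold mulVec dotProduct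
    simp only [Pi.add_apply]
    fun_prop
  have key : ∀ v : ι → ℝ, (stdGaussian ι {z | 0 ≤ β ⬝ᵥ (v + L *ᵥ z)}).toReal =
      1 - (stdGaussian ι {z | β ⬝ᵥ (v + L *ᵥ z) < 0}).toReal := by
    intro v
    have hcompl := probReal_compl_eq_one_sub (μ := stdGaussian ι)
      (measurableSet_lt (hmeas v) measurable_const (g := fun _ => (0 : ℝ)))
    have hset : {z | β ⬝ᵥ (v + L *ᵥ z) < 0}ᶜ = {z | 0 ≤ β ⬝ᵥ (v + L *ᵥ z)} := by
      ext z
      simp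
    rwa [hset] at hcompl
  rw [signError, signAccuracy, key, key]
  ring

theorem min_sq_mul_le_dotProduct_fromBlocks {m n : Type*} [Fintype m] [Fintype n]
    [DecidableEq m] [DecidableEq n] {σ1 σ2 : ℝ} (hσ1 : 0 < σ1) (hσ2 : 0 < σ2)
    {S : Matrix n n ℝ} (hS : (S - σ2 ^ 2 • (1 : Matrix n n ℝ)).PosSemidef)
    (β1 : m → ℝ) (β2 : n → ℝ) :
    min σ1 σ2 ^ 2 * (∑ i, β1 i ^ 2 + ∑ j, β2 j ^ 2) ≤
      Sum.elim β1 β2 ⬝ᵥ fromBlocks (σ1 ^ 2 • (1 : Matrix m m ℝ)) 0 0 S *ᵥ Sum.elim β1 β2 := by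
  have h := hS.dotProduct_mulVec_nonneg β2
  have hmin := lt_min hσ1 hσ2
  have h1 : min σ1 σ2 ^ 2 ≤ σ1 ^ 2 := by gcongr; exact min_le_left _ _
  have h2 : min σ1 σ2 ^ 2 ≤ σ2 ^ 2 := by gcongr; exact min_le_right _ _
  have e1 : β1 ⬝ᵥ β1 = ∑ i, β1 i ^ 2 := by simp [dotProduct, sq]
  have e2 : β2 ⬝ᵥ β2 = ∑ i, β2 i ^ 2 := by simp [dotProduct, sq]
  have n1 : 0 ≤ ∑ i, β1 i ^ 2 := by positivity
  have n2 : 0 ≤ ∑ i, β2 i ^ 2 := by positivity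
  simp only [star_trivial, sub_mulVec, smul_mulVec, one_mulVec, dotProduct_sub, dotProduct_smul,
    smul_eq_mul, e2] at h
  rw [fromBlocks_mulVec]
  simp only [Function.comp_def, Sum.elim_inl, Sum.elim_inr, zero_mulVec, add_zero, zero_add,
    sumElim_dotProduct_sumElim, smul_mulVec, one_mulVec, dotProduct_smul, smul_eq_mul, e1]
  nlinarith

/-- ERM lower bound: with invariant covariance `σ_1² I_r`, spurious covariances
`Σ_2^e ⪰ σ_2² I_{d_s}` symmetric, and means `±(μ_1, μ_2^e)` in training (resp.
`±(μ_1, −μ_2^e)` in test), any unit-norm linear classifier `β = (β_1, β_2)` with accuracy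
at least `Φ(2‖μ_1‖ / min(σ_1, σ_2))` on every training environment has 0-1 error at
least `1/2` on every test environment. -/
theorem erm_lower_bound {r ds E : ℕ} (hr : 1 ≤ r) (hds : 1 ≤ ds)
    (σ1 σ2 : ℝ) (hσ1 : 0 < σ1) (hσ2 : 0 < σ2)
    (μ1 : Fin r → ℝ) (μ2 : Fin E → (Fin ds → ℝ))
    (Sig2 : Fin E → Matrix (Fin ds) (Fin ds) ℝ)
    (hsymm : ∀ e, (Sig2 e).IsSymm)
    (hpsd : ∀ e, (Sig2 e - σ2 ^ 2 • (1 : Matrix (Fin ds) (Fin ds) ℝ)).PosSemidef)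
    (β1 : Fin r → ℝ) (β2 : Fin ds → ℝ)
    (hβ : Real.sqrt (∑ i, β1 i ^ 2 + ∑ j, β2 j ^ 2) = 1)
    (htrain : ∀ e (L : Matrix (Fin r ⊕ Fin ds) (Fin r ⊕ Fin ds) ℝ),
      L * Lᵀ = fromBlocks (σ1 ^ 2 • (1 : Matrix (Fin r) (Fin r) ℝ)) 0 0 (Sig2 e) →
      stdGaussianCDF (2 * Real.sqrt (∑ i, μ1 i ^ 2) / min σ1 σ2) ≤
        signAccuracy (Sum.elim β1 β2) (Sum.elim μ1 (μ2 e)) L) :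
    ∀ e (L : Matrix (Fin r ⊕ Fin ds) (Fin r ⊕ Fin ds) ℝ),
      L * Lᵀ = fromBlocks (σ1 ^ 2 • (1 : Matrix (Fin r) (Fin r) ℝ)) 0 0 (Sig2 e) →
      (1 : ℝ) / 2 ≤ signError (Sum.elim β1 β2) (Sum.elim μ1 (-(μ2 e))) L := by
  intro e L hL
  have hnorm : ∑ i, β1 i ^ 2 + ∑ j, β2 j ^ 2 = 1 := Real.sqrt_eq_one.1 hβ
  have hmin := lt_min hσ1 hσ2
  have hvar := min_sq_mul_le_dotProduct_fromBlocks hσ1 hσ2 (hpsd e) β1 β2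
  rw [hnorm, mul_one, ← hL] at hvar
  have hpos := (pow_pos hmin 2).trans_le hvar
  have hs : min σ1 σ2 ≤ √(Sum.elim β1 β2 ⬝ᵥ (L * Lᵀ) *ᵥ Sum.elim β1 β2) :=
    Real.le_sqrt_of_sq_le hvar
  have hacc := htrain e L hL
  rw [signAccuracy_eq_stdGaussianCDF _ _ _ hpos, strictMono_stdGaussianCDF.le_iff_le] at hacc
  rw [signError_eq_one_sub_signAccuracy, signAccuracy_eq_stdGaussianCDF _ _ _ hpos]
  set s := √(Sum.elim β1 β2 ⬝ᵥ (L * Lᵀ) *ᵥ Sum.elim β1 β2)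
  have hs0 : 0 < s := hmin.trans_le hs
  rw [sumElim_dotProduct_sumElim] at hacc ⊢
  have hμ := Real.sqrt_nonneg (∑ i, μ1 i ^ 2)
  have hmargin : 2 * √(∑ i, μ1 i ^ 2) ≤ β1 ⬝ᵥ μ1 + β2 ⬝ᵥ μ2 e := by
    rw [div_le_div_iff₀ hmin hs0] at hacc
    refine le_of_mul_le_mul_right ?_ hmin
    exact le_trans (by gcongr) hacc
  have hcs : β1 ⬝ᵥ μ1 ≤ √(∑ i, μ1 i ^ 2) := by
    have hβ1 : √(∑ i, β1 i ^ 2) ≤ 1 := by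
      have : 0 ≤ ∑ j, β2 j ^ 2 := by positivity
      exact Real.sqrt_le_one.2 (by linarith)
    exact (Real.sum_mul_le_sqrt_mul_sqrt _ _ _).trans (mul_le_of_le_one_left hμ hβ1)
  have htest : (β1 ⬝ᵥ μ1 + β2 ⬝ᵥ (-μ2 e)) / s ≤ 0 := by
    rw [dotProduct_neg]
    exact div_nonpos_of_nonpos_of_nonneg (by linarith) hs0.le
  have := strictMono_stdGaussianCDF.monotone htest
  rw [stdGaussianCDF_zero] at this
  linarith
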